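/- There exist δ₀ ∈ (0,1/2) and constants C₀ > 0 and c₀ > 0 such that the following holds. Let μ, ν ∈ (0,1] and let k be a nonzero integer. Let W : [0,∞) × [-1,1] → ℝ be smooth with ∂_t W = μ·∂_y² W on [0,∞) × [-1,1], W(t,-1) = W(t,1) = 0 for all t ≥ 0, and Σ_{j=0}^{4} ‖∂_y^j W(0,·)‖²_{L²} ≤ δ₀². Define U(t,y) := y + ∂_y[∫_{-1}^{1} G(y,y')·W(t,y') dy']. Let θ : [0,∞) × [-1,1] → ℂ be smooth with θ(t,-1) = θ(t,1) = 0 for all t ≥ 0, satisfying ∂_t θ + i·k·U·θ - ν·∂_y² θ = 0 on [0,∞) × [-1,1]. Then for all t ≥ 0: ‖θ(t,·)‖²_{L²} + ν^{2/3}·|k|^{-2/3}·‖∂_y θ(t,·)‖²_{L²} ≤ C₀·Φ_θ·exp(-c₀·ν^{1/3}·|k|^{2/3}·t), where Φ_θ := ‖θ(0,·)‖²_{L²} + ν^{2/3}·|k|^{-2/3}·‖∂_y θ(0,·)‖²_{L²}. -/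

import Mathlib

open Set

/-- The Green's function of `d²/dy²` on `[-1,1]` with homogeneous Dirichlet
boundary conditions. -/
noncomputable def G (y y' : ℝ) : ℝ :=
  if y ≤ y' then -((y' - 1) / 2) * (y + 1) else -((y' + 1) / 2) * (y - 1)

open MeasureTheory Filter Topology

section PartialDerivatives

variable {E : Type*} [NormedAddCommGroup E] [NormedSpace ℝ E] {f : ℝ → ℝ → E}

/-- The derivative in the first variable. -/
noncomputable def partialT (f : ℝ → ℝ → E) (t y : ℝ) : E := deriv (fun s => f s y) t

/-- The derivative in the second variable. -/
noncomputable def partialY (f : ℝ → ℝ → E) (t y : ℝ) : E := deriv (f t) y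

theorem hasDerivAt_fst_of_contDiff (hf : ContDiff ℝ (⊤ : ℕ∞) (Function.uncurry f)) (t y : ℝ) :
    HasDerivAt (fun s => f s y) (fderiv ℝ (Function.uncurry f) (t, y) (1, 0)) t :=
  HasFDerivAt.comp_hasDerivAt (l := Function.uncurry f) t
    ((hf.differentiable (by simp)) (t, y)).hasFDerivAt
    ((hasDerivAt_id' t).prodMk (hasDerivAt_const t y))

theorem hasDerivAt_snd_of_contDiff (hf : ContDiff ℝ (⊤ : ℕ∞) (Function.uncurry f)) (t y : ℝ) :
    HasDerivAt (f t) (fderiv ℝ (Function.uncurry f) (t, y) (0, 1)) y :=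
  ((hf.differentiable (by simp)) (t, y)).hasFDerivAt.comp_hasDerivAt y
    ((hasDerivAt_const y t).prodMk (hasDerivAt_id y))

theorem partialT_eq_fderiv (hf : ContDiff ℝ (⊤ : ℕ∞) (Function.uncurry f)) :
    partialT f = fun t y => fderiv ℝ (Function.uncurry f) (t, y) (1, 0) := by
  funext t y
  exact (hasDerivAt_fst_of_contDiff hf t y).deriv

theorem partialY_eq_fderiv (hf : ContDiff ℝ (⊤ : ℕ∞) (Function.uncurry f)) :
    partialY f = fun t y => fderiv ℝ (Function.uncurry f) (t, y) (0, 1) := by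
  funext t y
  exact (hasDerivAt_snd_of_contDiff hf t y).deriv

theorem hasDerivAt_partialT (hf : ContDiff ℝ (⊤ : ℕ∞) (Function.uncurry f)) (t y : ℝ) :
    HasDerivAt (fun s => f s y) (partialT f t y) t :=
  (hasDerivAt_fst_of_contDiff hf t y).differentiableAt.hasDerivAt

theorem hasDerivAt_partialY (hf : ContDiff ℝ (⊤ : ℕ∞) (Function.uncurry f)) (t y : ℝ) :
    HasDerivAt (f t) (partialY f t y) y :=
  (hasDerivAt_snd_of_contDiff hf t y).differentiableAt.hasDerivAt

theorem contDiff_partialT (hf : ContDiff ℝ (⊤ : ℕ∞) (Function.uncurry f)) :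
    ContDiff ℝ (⊤ : ℕ∞) (Function.uncurry (partialT f)) := by
  rw [partialT_eq_fderiv hf]
  exact (hf.fderiv_right (m := (⊤ : ℕ∞)) (by simp)).clm_apply contDiff_const

theorem contDiff_partialY (hf : ContDiff ℝ (⊤ : ℕ∞) (Function.uncurry f)) :
    ContDiff ℝ (⊤ : ℕ∞) (Function.uncurry (partialY f)) := by
  rw [partialY_eq_fderiv hf]
  exact (hf.fderiv_right (m := (⊤ : ℕ∞)) (by simp)).clm_apply contDiff_const

theorem partialT_partialY (hf : ContDiff ℝ (⊤ : ℕ∞) (Function.uncurry f)) :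
    partialT (partialY f) = partialY (partialT f) := by
  have hd : Differentiable ℝ (fderiv ℝ (Function.uncurry f)) :=
    (hf.fderiv_right (m := (⊤ : ℕ∞)) (by simp)).differentiable (by simp)
  have key : ∀ (v w : ℝ × ℝ) (z : ℝ × ℝ),
      fderiv ℝ (fun x => fderiv ℝ (Function.uncurry f) x v) z w
        = fderiv ℝ (fderiv ℝ (Function.uncurry f)) z w v := by
    intro v w z
    rw [fderiv_clm_apply (hd z) (differentiableAt_const v)]
    simp
  rw [partialT_eq_fderiv (contDiff_partialY hf), partialY_eq_fderiv (contDiff_partialT hf)]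
  funext t y
  rw [partialT_eq_fderiv hf, partialY_eq_fderiv hf]
  refine (key (0, 1) (1, 0) (t, y)).trans (Eq.trans ?_ (key (1, 0) (0, 1) (t, y)).symm)
  exact hf.contDiffAt.isSymmSndFDerivAt
    (by simpa using WithTop.coe_le_coe.2 (le_top : (2 : ℕ∞) ≤ ⊤)) _ _

theorem partialT_eq_zero_of_vanishing {y t : ℝ} (hy : ∀ s ≥ (0 : ℝ), f s y = 0) (ht : 0 < t) :
    partialT f t y = 0 := by
  have h : (fun s => f s y) =ᶠ[𝓝 t] fun _ => 0 := by
    filter_upwards [lt_mem_nhds ht] with s hs using hy s hs.le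
  rw [partialT, h.deriv_eq, deriv_const]

theorem hasDerivAt_integral_of_contDiff [CompleteSpace E]
    (hf : ContDiff ℝ (⊤ : ℕ∞) (Function.uncurry f)) (a b t : ℝ) :
    HasDerivAt (fun s => ∫ y in a..b, f s y) (∫ y in a..b, partialT f t y) t := by
  have hc : Continuous (Function.uncurry f) := hf.continuous
  have hc' : Continuous (Function.uncurry (partialT f)) := (contDiff_partialT hf).continuous
  have hfs : ∀ s, Continuous (f s) := fun s => hc.comp (by fun_prop : Continuous fun y => (s, y))
  have hfs' : ∀ s, Continuous (partialT f s) := fun s =>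
    hc'.comp (by fun_prop : Continuous fun y => (s, y))
  obtain ⟨M, hM⟩ := ((isCompact_closedBall t 1).prod (isCompact_uIcc (a := a) (b := b))
    ).exists_bound_of_continuousOn hc'.continuousOn
  refine (intervalIntegral.hasDerivAt_integral_of_dominated_loc_of_deriv_le (F := f)
    (F' := partialT f) (bound := fun _ => M) (Metric.closedBall_mem_nhds t one_pos)
    (Eventually.of_forall fun s => (hfs s).aestronglyMeasurable)
    ((hfs t).intervalIntegrable _ _) (hfs' t).aestronglyMeasurable
    (Eventually.of_forall fun y hy s hs => hM (s, y) ⟨hs, Set.uIoc_subset_uIcc hy⟩)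
    intervalIntegrable_const
    (Eventually.of_forall fun y _ s _ => hasDerivAt_partialT hf s y)).2

end PartialDerivatives

/-- Exponential decay of `∫ e` when the density `e` obeys a damped differential inequality up to
the divergence of a flux `F` that vanishes at the endpoints. -/
theorem integral_le_exp_of_flux {e F F' : ℝ → ℝ → ℝ} {κ : ℝ}
    (he : ContDiff ℝ (⊤ : ℕ∞) (Function.uncurry e))
    (hF : ∀ t > 0, ∀ y, HasDerivAt (F t) (F' t y) y)
    (hF0 : ∀ t > 0, F t (-1) = 0 ∧ F t 1 = 0)
    (hle : ∀ t > 0, ∀ y ∈ Ioo (-1 : ℝ) 1, partialT e t y + κ * e t y ≤ F' t y)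
    {t : ℝ} (ht : 0 ≤ t) :
    ∫ y in (-1 : ℝ)..1, e t y ≤ (∫ y in (-1 : ℝ)..1, e 0 y) * Real.exp (-(κ * t)) := by
  have hD := hasDerivAt_integral_of_contDiff he (-1) 1
  have hG : ∀ s, HasDerivAt (fun s => (∫ y in (-1 : ℝ)..1, e s y) * Real.exp (κ * s))
      (((∫ y in (-1 : ℝ)..1, partialT e s y) + κ * ∫ y in (-1 : ℝ)..1, e s y)
        * Real.exp (κ * s)) s := by
    intro s
    have h := (hD s).mul (((hasDerivAt_id s).const_mul κ).exp)
    convert! h using 1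
    simp only [id]
    ring
  have hanti : AntitoneOn (fun s => (∫ y in (-1 : ℝ)..1, e s y) * Real.exp (κ * s)) (Ici 0) := by
    refine antitoneOn_of_deriv_nonpos (convex_Ici 0)
      (fun s _ => (hG s).continuousAt.continuousWithinAt)
      (fun s _ => (hG s).differentiableAt.differentiableWithinAt) fun s hs => ?_
    rw [interior_Ici] at hs
    rw [(hG s).deriv]
    have hce : Continuous (e s) := he.continuous.comp (by fun_prop : Continuous fun y => (s, y))
    have hce' : Continuous (partialT e s) :=
      (contDiff_partialT he).continuous.comp (by fun_prop : Continuous fun y => (s, y))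
    have hflux := intervalIntegral.integral_le_sub_of_hasDeriv_right_of_le
      (φ := fun y => partialT e s y + κ * e s y) (by norm_num : (-1 : ℝ) ≤ 1)
      (fun y _ => (hF s hs y).continuousAt.continuousWithinAt)
      (fun y _ => (hF s hs y).hasDerivWithinAt)
      ((hce'.add (hce.const_mul κ)).continuousOn.integrableOn_Icc) (hle s hs)
    rw [intervalIntegral.integral_add (hce'.intervalIntegrable _ _)
      ((hce.const_mul κ).intervalIntegrable _ _), intervalIntegral.integral_const_mul,
      (hF0 s hs).1, (hF0 s hs).2, sub_zero] at hflux
    exact mul_nonpos_of_nonpos_of_nonneg hflux (Real.exp_pos _).le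
  have h := hanti self_mem_Ici ht ht
  simp only [mul_zero, Real.exp_zero, mul_one] at h
  rw [Real.exp_neg, ← div_eq_mul_inv]
  exact (le_div_iff₀ (Real.exp_pos _)).2 h

/-- Solutions of the Dirichlet heat equation with small initial `H¹` seminorm stay small. -/
theorem abs_heat_le {W : ℝ → ℝ → ℝ} {μ : ℝ} (hμ : 0 < μ)
    (hW : ContDiff ℝ (⊤ : ℕ∞) (Function.uncurry W))
    (heq : ∀ t ≥ (0 : ℝ), ∀ y ∈ Icc (-1 : ℝ) 1, partialT W t y = μ * partialY (partialY W) t y)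
    (hbc : ∀ t ≥ (0 : ℝ), W t (-1) = 0 ∧ W t 1 = 0)
    (hinit : ∫ y in (-1 : ℝ)..1, (partialY W 0 y) ^ 2 ≤ 1 / 16)
    {t : ℝ} (ht : 0 ≤ t) {y : ℝ} (hy : y ∈ Icc (-1 : ℝ) 1) : |W t y| ≤ 1 / 2 := by
  have hWy := contDiff_partialY hW
  have hWt := contDiff_partialT hW
  have he : ContDiff ℝ (⊤ : ℕ∞) (Function.uncurry fun t y => (partialY W t y) ^ 2) := hWy.pow 2
  have henergy : ∫ y in (-1 : ℝ)..1, (partialY W t y) ^ 2 ≤ 1 / 16 := by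
    have h := integral_le_exp_of_flux (κ := 0)
      (F := fun t y => 2 * (partialY W t y * partialT W t y))
      (F' := fun t y => 2 * (partialY (partialY W) t y * partialT W t y
        + partialY W t y * partialY (partialT W) t y)) he
      (fun s _ z => ((hasDerivAt_partialY hWy s z).mul (hasDerivAt_partialY hWt s z)).const_mul 2)
      (fun s hs => by
        simp [partialT_eq_zero_of_vanishing (fun r hr => (hbc r hr).1) hs,
          partialT_eq_zero_of_vanishing (fun r hr => (hbc r hr).2) hs])
      (fun s hs z hz => by
        have h1 : partialT (fun t y => (partialY W t y) ^ 2) s z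
            = 2 * partialY W s z * partialY (partialT W) s z := by
          rw [← partialT_partialY hW]
          refine ((hasDerivAt_partialT hWy s z).pow 2).deriv.trans ?_
          simp
        rw [h1, heq s hs.le z (Ioo_subset_Icc_self hz)]
        nlinarith [mul_nonneg hμ.le (sq_nonneg (partialY (partialY W) s z))]) ht
    simp only [zero_mul, neg_zero, Real.exp_zero, mul_one] at h
    exact h.trans hinit
  have hcy : Continuous (partialY W t) :=
    hWy.continuous.comp (by fun_prop : Continuous fun y => (t, y))
  have hci : Continuous fun z => 2 * (partialY W t z) ^ 2 + 1 / 8 := by fun_prop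
  have hbound : ∀ σ : ℝ, σ ^ 2 = 1 → σ * W t y ≤ 1 / 2 := by
    intro σ hσ
    have hcy' : ∫ z in (-1 : ℝ)..y, σ * partialY W t z = σ * W t y := by
      rw [intervalIntegral.integral_const_mul, intervalIntegral.integral_eq_sub_of_hasDerivAt
        (fun z _ => hasDerivAt_partialY hW t z) (hcy.intervalIntegrable _ _),
        (hbc t ht).1, sub_zero]
    rw [← hcy']
    calc ∫ z in (-1 : ℝ)..y, σ * partialY W t z
        ≤ ∫ z in (-1 : ℝ)..y, (2 * (partialY W t z) ^ 2 + 1 / 8) :=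
          intervalIntegral.integral_mono_on hy.1 ((hcy.const_mul σ).intervalIntegrable _ _)
            (hci.intervalIntegrable _ _)
            fun z _ => by nlinarith [sq_nonneg (σ * partialY W t z - 1 / 4)]
      _ ≤ ∫ z in (-1 : ℝ)..1, (2 * (partialY W t z) ^ 2 + 1 / 8) :=
          intervalIntegral.integral_mono_interval le_rfl hy.1 hy.2
            (Eventually.of_forall fun z => by positivity) (hci.intervalIntegrable _ _)
      _ = 2 * (∫ z in (-1 : ℝ)..1, (partialY W t z) ^ 2) + 1 / 4 := by
          rw [intervalIntegral.integral_add (Continuous.intervalIntegrable (by fun_prop) _ _)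
            intervalIntegrable_const, intervalIntegral.integral_const_mul,
            intervalIntegral.integral_const]
          norm_num
      _ ≤ 1 / 2 := by linarith
  exact abs_le.2 ⟨by linarith [hbound (-1) (by norm_num)], by linarith [hbound 1 (by norm_num)]⟩

theorem G_eq_sub_max (z y : ℝ) : G z y = (1 - y) / 2 * (z + 1) - max (z - y) 0 := by
  unfold G
  split_ifs with h
  · rw [max_eq_right (by linarith)]
    ring
  · rw [max_eq_left (by linarith)]
    ring

/-- The primitive of `1 - w` that agrees with the velocity generated by the vorticity `w`. -/
noncomputable def shearVelocity (w : ℝ → ℝ) (y : ℝ) : ℝ :=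
  y + ((∫ x in (-1 : ℝ)..1, (1 - x) / 2 * w x) - ∫ x in (-1 : ℝ)..y, w x)

theorem hasDerivAt_shearVelocity {w : ℝ → ℝ} (hw : Continuous w) (y : ℝ) :
    HasDerivAt (shearVelocity w) (1 - w y) y := by
  have h := (hasDerivAt_id y).add ((intervalIntegral.integral_hasDerivAt_right
    (hw.intervalIntegrable (-1) y) hw.aestronglyMeasurable.stronglyMeasurableAtFilter
    hw.continuousAt).const_sub (∫ x in (-1 : ℝ)..1, (1 - x) / 2 * w x))
  convert! h using 1

theorem add_deriv_integral_G {w : ℝ → ℝ} (hw : Continuous w) {y : ℝ} (hy : y ∈ Ioo (-1 : ℝ) 1) :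
    y + deriv (fun z => ∫ x in (-1 : ℝ)..1, G z x * w x) y = shearVelocity w y := by
  have heq : (fun z => ∫ x in (-1 : ℝ)..1, G z x * w x) =ᶠ[𝓝 y] fun z =>
      (z + 1) * (∫ x in (-1 : ℝ)..1, (1 - x) / 2 * w x)
        - (z * (∫ x in (-1 : ℝ)..z, w x) - ∫ x in (-1 : ℝ)..z, x * w x) := by
    filter_upwards [Ioo_mem_nhds hy.1 hy.2] with z hz
    have hleft : ∫ x in (-1 : ℝ)..z, max (z - x) 0 * w x
        = z * (∫ x in (-1 : ℝ)..z, w x) - ∫ x in (-1 : ℝ)..z, x * w x := by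
      rw [← intervalIntegral.integral_const_mul, ← intervalIntegral.integral_sub
        (Continuous.intervalIntegrable (by fun_prop) _ _)
        (Continuous.intervalIntegrable (by fun_prop) _ _)]
      refine intervalIntegral.integral_congr fun x hx => ?_
      rw [uIcc_of_le hz.1.le] at hx
      simp only [max_eq_left (sub_nonneg.2 hx.2)]
      ring
    have hright : ∫ x in z..1, max (z - x) 0 * w x = 0 := by
      rw [intervalIntegral.integral_congr (g := fun _ => (0 : ℝ)), intervalIntegral.integral_zero]
      intro x hx
      rw [uIcc_of_le hz.2.le] at hx
      simp only [max_eq_right (sub_nonpos.2 hx.1), zero_mul]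
    have hsplit := intervalIntegral.integral_add_adjacent_intervals (μ := volume)
      (Continuous.intervalIntegrable (by fun_prop : Continuous fun x => max (z - x) 0 * w x) (-1) z)
      (Continuous.intervalIntegrable (by fun_prop : Continuous fun x => max (z - x) 0 * w x) z 1)
    rw [← hleft, ← intervalIntegral.integral_const_mul]
    rw [hright, add_zero] at hsplit
    rw [hsplit, ← intervalIntegral.integral_sub (Continuous.intervalIntegrable (by fun_prop) _ _)
        (Continuous.intervalIntegrable (by fun_prop) _ _)]
    refine intervalIntegral.integral_congr fun x _ => ?_
    simp only [G_eq_sub_max]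
    ring
  have hprim : ∀ {g : ℝ → ℝ}, Continuous g →
      HasDerivAt (fun z => ∫ x in (-1 : ℝ)..z, g x) (g y) y := fun hg =>
    intervalIntegral.integral_hasDerivAt_right (hg.intervalIntegrable (-1) y)
      hg.aestronglyMeasurable.stronglyMeasurableAtFilter hg.continuousAt
  have hderiv := (((hasDerivAt_id y).add_const 1).mul_const
    (∫ x in (-1 : ℝ)..1, (1 - x) / 2 * w x)).sub
    (((hasDerivAt_id y).mul (hprim hw)).sub (hprim (continuous_id.mul hw)))
  rw [heq.deriv_eq]
  refine (congrArg (y + ·) hderiv.deriv).trans ?_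
  simp only [shearVelocity, id, Pi.mul_apply]
  ring

theorem hypocoercive_dissipation {a b p q A B s w : ℝ} (hs : s ^ 2 = 1)
    (hw : w ∈ Icc (1 / 2 : ℝ) (3 / 2)) :
    -2 * (p ^ 2 + q ^ 2) + 1 / 8 * (-(A ^ 2 + B ^ 2) + s * w * (p * b - q * a))
      + 1 / 8 * (2 * s * (A * q - B * p) - w * (a ^ 2 + b ^ 2))
      + 1 / 48 * (a ^ 2 + b ^ 2 + 1 / 16 * (p ^ 2 + q ^ 2) + 1 / 8 * s * (a * q - b * p)) ≤ 0 := by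
  have hcross : ∀ u v : ℝ, s * (u * v) ≤ (u ^ 2 + v ^ 2) / 2 := fun u v => by
    nlinarith [sq_nonneg (s * u - v)]
  have hcross' : ∀ u v : ℝ, -(s * (u * v)) ≤ (u ^ 2 + v ^ 2) / 2 := fun u v => by
    nlinarith [sq_nonneg (s * u + v)]
  have hshear : w * (s * (p * b) - s * (q * a) - (a ^ 2 + b ^ 2))
      ≤ w * ((p ^ 2 + q ^ 2) / 2 - (a ^ 2 + b ^ 2) / 2) :=
    mul_le_mul_of_nonneg_left (by linarith [hcross p b, hcross' q a]) (by linarith [hw.1])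
  have hwX : 1 / 2 * (a ^ 2 + b ^ 2) ≤ w * (a ^ 2 + b ^ 2) :=
    mul_le_mul_of_nonneg_right hw.1 (by positivity)
  have hwY : w * (p ^ 2 + q ^ 2) ≤ 3 / 2 * (p ^ 2 + q ^ 2) :=
    mul_le_mul_of_nonneg_right hw.2 (by positivity)
  linarith [hcross A q, hcross' B p, hcross a q, hcross' b p, sq_nonneg a, sq_nonneg b,
    sq_nonneg p, sq_nonneg q]

/-- The hypocoercivity density of `a + i b`, with `p`, `q` the derivatives of `a`, `b`. -/
noncomputable def hypocoerciveDensity (ε s a b p q : ℝ) : ℝ :=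
  a ^ 2 + b ^ 2 + 1 / 16 * ε ^ 2 * (p ^ 2 + q ^ 2) + 1 / 8 * ε * s * (a * q - b * p)

theorem le_hypocoerciveDensity {ε s a b p q : ℝ} (hs : s ^ 2 = 1) :
    1 / 32 * (a ^ 2 + b ^ 2 + ε ^ 2 * (p ^ 2 + q ^ 2)) ≤ hypocoerciveDensity ε s a b p q := by
  unfold hypocoerciveDensity
  have h1 : 0 ≤ (s * a + 1 / 8 * (ε * q)) ^ 2 := sq_nonneg _
  have h2 : 0 ≤ (s * b - 1 / 8 * (ε * p)) ^ 2 := sq_nonneg _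
  have h3 : s ^ 2 * a ^ 2 = a ^ 2 := by rw [hs, one_mul]
  have h4 : s ^ 2 * b ^ 2 = b ^ 2 := by rw [hs, one_mul]
  nlinarith [sq_nonneg a, sq_nonneg b, sq_nonneg (ε * p), sq_nonneg (ε * q)]

theorem hypocoerciveDensity_le {ε s a b p q : ℝ} (hs : s ^ 2 = 1) :
    hypocoerciveDensity ε s a b p q ≤ 3 / 2 * (a ^ 2 + b ^ 2 + ε ^ 2 * (p ^ 2 + q ^ 2)) := by
  unfold hypocoerciveDensity
  have h1 : 0 ≤ (s * a - 1 / 8 * (ε * q)) ^ 2 := sq_nonneg _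
  have h2 : 0 ≤ (s * b + 1 / 8 * (ε * p)) ^ 2 := sq_nonneg _
  have h3 : s ^ 2 * a ^ 2 = a ^ 2 := by rw [hs, one_mul]
  have h4 : s ^ 2 * b ^ 2 = b ^ 2 := by rw [hs, one_mul]
  nlinarith [sq_nonneg a, sq_nonneg b, sq_nonneg (ε * p), sq_nonneg (ε * q)]

/-- Enhanced dissipation of the hypocoercivity functional for the real and imaginary parts of a
solution of the advection-diffusion equation with shear velocity `V`. -/
theorem hypocoercive_decay {a b V w : ℝ → ℝ → ℝ} {ε lam s k ν : ℝ}
    (hlam : 0 ≤ lam) (hs : s ^ 2 = 1) (hν : ν = ε ^ 2 * lam) (hk : k * ε = s * lam)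
    (ha : ContDiff ℝ (⊤ : ℕ∞) (Function.uncurry a))
    (hb : ContDiff ℝ (⊤ : ℕ∞) (Function.uncurry b))
    (hV : ∀ t > 0, ∀ y, HasDerivAt (V t) (w t y) y)
    (hw : ∀ t > 0, ∀ y ∈ Ioo (-1 : ℝ) 1, w t y ∈ Icc (1 / 2 : ℝ) (3 / 2))
    (ha0 : ∀ t ≥ (0 : ℝ), a t (-1) = 0 ∧ a t 1 = 0)
    (hb0 : ∀ t ≥ (0 : ℝ), b t (-1) = 0 ∧ b t 1 = 0)
    (hat : ∀ t > 0, ∀ y ∈ Ioo (-1 : ℝ) 1,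
      partialT a t y = k * V t y * b t y + ν * partialY (partialY a) t y)
    (hbt : ∀ t > 0, ∀ y ∈ Ioo (-1 : ℝ) 1,
      partialT b t y = -(k * V t y * a t y) + ν * partialY (partialY b) t y)
    {t : ℝ} (ht : 0 ≤ t) :
    ∫ y in (-1 : ℝ)..1, hypocoerciveDensity ε s (a t y) (b t y) (partialY a t y) (partialY b t y) ≤
      (∫ y in (-1 : ℝ)..1,
        hypocoerciveDensity ε s (a 0 y) (b 0 y) (partialY a 0 y) (partialY b 0 y))
        * Real.exp (-(1 / 48 * lam * t)) := by
  have hay := contDiff_partialY ha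
  have hby := contDiff_partialY hb
  have hatc := contDiff_partialT ha
  have hbtc := contDiff_partialT hb
  have he : ContDiff ℝ (⊤ : ℕ∞) (Function.uncurry fun t y =>
      hypocoerciveDensity ε s (a t y) (b t y) (partialY a t y) (partialY b t y)) :=
    (((ha.pow 2).add (hb.pow 2)).add (contDiff_const.mul ((hay.pow 2).add (hby.pow 2)))).add
      (contDiff_const.mul ((ha.mul hby).sub (hb.mul hay)))
  refine integral_le_exp_of_flux (e := fun t y =>
      hypocoerciveDensity ε s (a t y) (b t y) (partialY a t y) (partialY b t y))
    (F := fun t y => 2 * ν * (a t y * partialY a t y + b t y * partialY b t y)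
      + 1 / 8 * ε ^ 2 * (partialY a t y * partialT a t y + partialY b t y * partialT b t y
        - k * (V t y * (partialY a t y * b t y - partialY b t y * a t y)))
      + 1 / 8 * ε * s * (a t y * partialT b t y - b t y * partialT a t y
        + k * (V t y * (a t y * a t y + b t y * b t y))))
    (F' := fun t y => 2 * ν * (partialY a t y * partialY a t y + a t y * partialY (partialY a) t y
        + (partialY b t y * partialY b t y + b t y * partialY (partialY b) t y))
      + 1 / 8 * ε ^ 2 * (partialY (partialY a) t y * partialT a t y
        + partialY a t y * partialY (partialT a) t y
        + (partialY (partialY b) t y * partialT b t y + partialY b t y * partialY (partialT b) t y)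
        - k * (w t y * (partialY a t y * b t y - partialY b t y * a t y)
          + V t y * (partialY (partialY a) t y * b t y + partialY a t y * partialY b t y
            - (partialY (partialY b) t y * a t y + partialY b t y * partialY a t y))))
      + 1 / 8 * ε * s * (partialY a t y * partialT b t y + a t y * partialY (partialT b) t y
        - (partialY b t y * partialT a t y + b t y * partialY (partialT a) t y)
        + k * (w t y * (a t y * a t y + b t y * b t y)
          + V t y * (partialY a t y * a t y + a t y * partialY a t y
            + (partialY b t y * b t y + b t y * partialY b t y))))) he
    (fun t ht y => ?_) (fun t ht => ?_) (fun t ht y hy => ?_) ht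
  · have dV := hV t ht y
    have da := hasDerivAt_partialY ha t y
    have db := hasDerivAt_partialY hb t y
    have day := hasDerivAt_partialY hay t y
    have dby := hasDerivAt_partialY hby t y
    have dat := hasDerivAt_partialY hatc t y
    have dbt := hasDerivAt_partialY hbtc t y
    exact ((((da.mul day).add (db.mul dby)).const_mul (2 * ν)).add
      ((((day.mul dat).add (dby.mul dbt)).sub
        ((dV.mul ((day.mul db).sub (dby.mul da))).const_mul k)).const_mul (1 / 8 * ε ^ 2))).add
      ((((da.mul dbt).sub (db.mul dat)).add
        ((dV.mul ((da.mul da).add (db.mul db))).const_mul k)).const_mul (1 / 8 * ε * s))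
  · simp [partialT_eq_zero_of_vanishing (fun r hr => (ha0 r hr).1) ht,
      partialT_eq_zero_of_vanishing (fun r hr => (ha0 r hr).2) ht,
      partialT_eq_zero_of_vanishing (fun r hr => (hb0 r hr).1) ht,
      partialT_eq_zero_of_vanishing (fun r hr => (hb0 r hr).2) ht,
      (ha0 t (le_of_lt ht)).1, (ha0 t (le_of_lt ht)).2, (hb0 t (le_of_lt ht)).1,
      (hb0 t (le_of_lt ht)).2]
  · have da := hasDerivAt_partialT ha t y
    have db := hasDerivAt_partialT hb t y
    have day := hasDerivAt_partialT hay t y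
    have dby := hasDerivAt_partialT hby t y
    have hderiv : partialT (fun t y =>
        hypocoerciveDensity ε s (a t y) (b t y) (partialY a t y) (partialY b t y)) t y = _ :=
      ((((da.pow 2).add (db.pow 2)).add
        (((day.pow 2).add (dby.pow 2)).const_mul (1 / 16 * ε ^ 2))).add
        (((da.mul dby).sub (db.mul day)).const_mul (1 / 8 * ε * s))).deriv
    rw [hderiv, partialT_partialY ha, partialT_partialY hb, hat t ht y hy, hbt t ht y hy]
    have hdiss := mul_nonpos_of_nonneg_of_nonpos hlam (hypocoercive_dissipation (a := a t y)
      (b := b t y) (p := ε * partialY a t y) (q := ε * partialY b t y)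
      (A := ε ^ 2 * partialY (partialY a) t y) (B := ε ^ 2 * partialY (partialY b) t y)
      hs (hw t ht y hy))
    have hskε : ε * s * k = lam := by linear_combination s * hk + lam * hs
    rw [← sub_nonpos]
    refine le_of_eq_of_le ?_ hdiss
    simp only [hypocoerciveDensity, Nat.cast_ofNat, Nat.add_one_sub_one, pow_one]
    generalize partialY (partialY a) t y = A
    generalize partialY (partialY b) t y = B
    generalize partialY (partialT a) t y = P
    generalize partialY (partialT b) t y = Q
    generalize partialY a t y = p
    generalize partialY b t y = q
    generalize a t y = x
    generalize b t y = z
    generalize V t y = v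
    generalize w t y = w
    subst hν
    linear_combination (1 / 8 * ε * w * (p * z - q * x)) * hk - (1 / 8 * w * (x ^ 2 + z ^ 2)) * hskε

theorem rpow_scaling {ν K : ℝ} (hν : 0 < ν) (hK : 0 < K) :
    (ν ^ ((1 : ℝ) / 3) * K ^ (-(1 : ℝ) / 3)) ^ 2 = ν ^ ((2 : ℝ) / 3) * K ^ (-(2 : ℝ) / 3) ∧
    ν = (ν ^ ((1 : ℝ) / 3) * K ^ (-(1 : ℝ) / 3)) ^ 2 * (ν ^ ((1 : ℝ) / 3) * K ^ ((2 : ℝ) / 3)) ∧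
    K * (ν ^ ((1 : ℝ) / 3) * K ^ (-(1 : ℝ) / 3)) = ν ^ ((1 : ℝ) / 3) * K ^ ((2 : ℝ) / 3) := by
  have h1 : (ν ^ ((1 : ℝ) / 3) * K ^ (-(1 : ℝ) / 3)) ^ 2
      = ν ^ ((2 : ℝ) / 3) * K ^ (-(2 : ℝ) / 3) := by
    rw [mul_pow, ← Real.rpow_mul_natCast hν.le, ← Real.rpow_mul_natCast hK.le]
    norm_num
  refine ⟨h1, ?_, ?_⟩
  · rw [h1, mul_mul_mul_comm, ← Real.rpow_add hν, ← Real.rpow_add hK]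
    norm_num
  · rw [mul_left_comm]
    nth_rewrite 1 [← Real.rpow_one K]
    rw [← Real.rpow_add hK]
    norm_num

theorem stmt_15 :
    ∃ δ₀ : ℝ, δ₀ ∈ Ioo (0:ℝ) (1/2) ∧ ∃ C₀ : ℝ, 0 < C₀ ∧ ∃ c₀ : ℝ, 0 < c₀ ∧
    ∀ μ ν : ℝ, μ ∈ Ioc (0:ℝ) 1 → ν ∈ Ioc (0:ℝ) 1 →
    ∀ k : ℤ, k ≠ 0 →
    ∀ W : ℝ → ℝ → ℝ, ContDiff ℝ (⊤ : ℕ∞) (Function.uncurry W) →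
    (∀ t ≥ (0:ℝ), ∀ y ∈ Icc (-1:ℝ) 1,
      deriv (fun s => W s y) t = μ * deriv (deriv (W t)) y) →
    (∀ t ≥ (0:ℝ), W t (-1) = 0 ∧ W t 1 = 0) →
    (∑ j ∈ Finset.range 5, ∫ y in (-1:ℝ)..1, (deriv^[j] (W 0) y)^2) ≤ δ₀^2 →
    ∀ U : ℝ → ℝ → ℝ,
    (∀ t y, U t y = y + deriv (fun z => ∫ y' in (-1:ℝ)..1, G z y' * W t y') y) →
    ∀ θ : ℝ → ℝ → ℂ, ContDiff ℝ (⊤ : ℕ∞) (Function.uncurry θ) →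
    (∀ t ≥ (0:ℝ), θ t (-1) = 0 ∧ θ t 1 = 0) →
    (∀ t ≥ (0:ℝ), ∀ y ∈ Icc (-1:ℝ) 1,
      deriv (fun s => θ s y) t + Complex.I * (k : ℂ) * (U t y : ℂ) * θ t y
        - (ν : ℂ) * deriv (deriv (θ t)) y = 0) →
    ∀ t ≥ (0:ℝ),
      (∫ y in (-1:ℝ)..1, ‖θ t y‖^2)
          + ν ^ ((2:ℝ)/3) * |(k : ℝ)| ^ (-(2:ℝ)/3) *
              (∫ y in (-1:ℝ)..1, ‖deriv (θ t) y‖^2) ≤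
        C₀ * ((∫ y in (-1:ℝ)..1, ‖θ 0 y‖^2)
            + ν ^ ((2:ℝ)/3) * |(k : ℝ)| ^ (-(2:ℝ)/3) *
                (∫ y in (-1:ℝ)..1, ‖deriv (θ 0) y‖^2)) *
          Real.exp (-(c₀ * ν ^ ((1:ℝ)/3) * |(k : ℝ)| ^ ((2:ℝ)/3) * t)) := by
  refine ⟨1 / 4, by norm_num, 48, by norm_num, 1 / 48, by norm_num, ?_⟩
  intro μ ν hμ hν k hk W hW hWeq hWbc hWinit U hU θ hθ hθbc hθeq t ht
  have hK : 0 < |(k : ℝ)| := abs_pos.2 (Int.cast_ne_zero.2 hk)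
  obtain ⟨hε2, hνε, hKε⟩ := rpow_scaling hν.1 hK
  set ε := ν ^ ((1 : ℝ) / 3) * |(k : ℝ)| ^ (-(1 : ℝ) / 3)
  set lam := ν ^ ((1 : ℝ) / 3) * |(k : ℝ)| ^ ((2 : ℝ) / 3) with hlam_def
  have hlam : 0 ≤ lam := mul_nonneg (Real.rpow_nonneg hν.1.le _) (Real.rpow_nonneg hK.le _)
  obtain ⟨s, hs, hsk⟩ : ∃ s : ℝ, s ^ 2 = 1 ∧ (k : ℝ) = s * |(k : ℝ)| := by
    rcases abs_choice (k : ℝ) with h | h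
    · exact ⟨1, by norm_num, by rw [h, one_mul]⟩
    · exact ⟨-1, by norm_num, by rw [h]; ring⟩
  have hkε : (k : ℝ) * ε = s * lam := by rw [hsk, mul_assoc, hKε]
  have hWy0 : ∫ y in (-1 : ℝ)..1, (partialY W 0 y) ^ 2 ≤ 1 / 16 := by
    have h := Finset.single_le_sum
      (f := fun j => ∫ y in (-1 : ℝ)..1, (deriv^[j] (W 0) y) ^ 2) (s := Finset.range 5)
      (fun j _ => intervalIntegral.integral_nonneg (by norm_num) fun y _ => sq_nonneg _)
      (Finset.mem_range.2 (by norm_num : 1 < 5))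
    exact (h.trans hWinit).trans (by norm_num)
  have hWc : ∀ r, Continuous (W r) := fun r =>
    hW.continuous.comp (by fun_prop : Continuous fun y => (r, y))
  have hWle : ∀ r ≥ (0 : ℝ), ∀ y ∈ Icc (-1 : ℝ) 1, |W r y| ≤ 1 / 2 := fun r hr y hy =>
    abs_heat_le hμ.1 hW hWeq hWbc hWy0 hr hy
  have ha : ContDiff ℝ (⊤ : ℕ∞) (Function.uncurry fun r y => (θ r y).re) :=
    Complex.reCLM.contDiff.comp hθ
  have hb : ContDiff ℝ (⊤ : ℕ∞) (Function.uncurry fun r y => (θ r y).im) :=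
    Complex.imCLM.contDiff.comp hθ
  have hθy := contDiff_partialY hθ
  have hre : ∀ {f : ℝ → ℂ} {d : ℂ} {x : ℝ}, HasDerivAt f d x →
      HasDerivAt (fun z => (f z).re) d.re x := fun h =>
    Complex.reCLM.hasFDerivAt.comp_hasDerivAt _ h
  have him : ∀ {f : ℝ → ℂ} {d : ℂ} {x : ℝ}, HasDerivAt f d x →
      HasDerivAt (fun z => (f z).im) d.im x := fun h =>
    Complex.imCLM.hasFDerivAt.comp_hasDerivAt _ h
  have hay : partialY (fun r y => (θ r y).re) = fun r y => (partialY θ r y).re := by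
    funext r y
    exact (hre (hasDerivAt_partialY hθ r y)).deriv
  have hby : partialY (fun r y => (θ r y).im) = fun r y => (partialY θ r y).im := by
    funext r y
    exact (him (hasDerivAt_partialY hθ r y)).deriv
  have heq : ∀ r > 0, ∀ y ∈ Ioo (-1 : ℝ) 1, partialT θ r y
      = -(Complex.I * (k : ℂ) * (shearVelocity (W r) y : ℂ) * θ r y)
        + (ν : ℂ) * partialY (partialY θ) r y := by
    intro r hr y hy
    have h := hθeq r (le_of_lt hr) y (Ioo_subset_Icc_self hy)
    rw [hU, add_deriv_integral_G (hWc r) hy] at h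
    change partialT θ r y + _ - (ν : ℂ) * partialY (partialY θ) r y = 0 at h
    linear_combination h
  have hdecay := hypocoercive_decay (a := fun r y => (θ r y).re) (b := fun r y => (θ r y).im)
    (V := fun r => shearVelocity (W r)) (w := fun r y => 1 - W r y) hlam hs hνε hkε ha hb
    (fun r _ y => hasDerivAt_shearVelocity (hWc r) y)
    (fun r hr y hy => by
      have h := abs_le.1 (hWle r (le_of_lt hr) y (Ioo_subset_Icc_self hy))
      exact ⟨by linarith [h.2], by linarith [h.1]⟩)
    (fun r hr => by simp [hθbc r hr]) (fun r hr => by simp [hθbc r hr])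
    (fun r hr y hy => by
      rw [hay]
      refine (hre (hasDerivAt_partialT hθ r y)).deriv.trans ?_
      rw [heq r hr y hy, show partialY (fun r y => (partialY θ r y).re) r y
        = (partialY (partialY θ) r y).re from (hre (hasDerivAt_partialY hθy r y)).deriv]
      simp)
    (fun r hr y hy => by
      rw [hby]
      refine (him (hasDerivAt_partialT hθ r y)).deriv.trans ?_
      rw [heq r hr y hy, show partialY (fun r y => (partialY θ r y).im) r y
        = (partialY (partialY θ) r y).im from (him (hasDerivAt_partialY hθy r y)).deriv]
      simp)
    ht
  rw [hay, hby] at hdecay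
  have hθc : ∀ r, Continuous (θ r) := fun r =>
    hθ.continuous.comp (by fun_prop : Continuous fun y => (r, y))
  have hθyc : ∀ r, Continuous (partialY θ r) := fun r =>
    hθy.continuous.comp (by fun_prop : Continuous fun y => (r, y))
  have hdens : ∀ r, Continuous fun y => hypocoerciveDensity ε s (θ r y).re (θ r y).im
      (partialY θ r y).re (partialY θ r y).im := fun r => by
    have h1 := hθc r
    have h2 := hθyc r
    unfold hypocoerciveDensity
    fun_prop
  have hnorm : ∀ z : ℂ, ‖z‖ ^ 2 = z.re ^ 2 + z.im ^ 2 := fun z => by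
    rw [Complex.sq_norm, Complex.normSq_apply]
    ring
  have hsumc : ∀ r, Continuous fun y => ‖θ r y‖ ^ 2 + ε ^ 2 * ‖partialY θ r y‖ ^ 2 := fun r => by
    have h1 := hθc r
    have h2 := hθyc r
    fun_prop
  have hsum : ∀ r, (∫ y in (-1 : ℝ)..1, ‖θ r y‖ ^ 2)
      + ε ^ 2 * (∫ y in (-1 : ℝ)..1, ‖deriv (θ r) y‖ ^ 2)
      = ∫ y in (-1 : ℝ)..1, (‖θ r y‖ ^ 2 + ε ^ 2 * ‖partialY θ r y‖ ^ 2) := fun r => by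
    have h1 := hθc r
    have h2 := hθyc r
    rw [intervalIntegral.integral_add (Continuous.intervalIntegrable (by fun_prop) _ _)
      (Continuous.intervalIntegrable (by fun_prop) _ _), intervalIntegral.integral_const_mul]
    rfl
  rw [← hε2, hsum t, hsum 0, mul_assoc (1 / 48 : ℝ), ← hlam_def]
  have hlow : 1 / 32 * (∫ y in (-1 : ℝ)..1, (‖θ t y‖ ^ 2 + ε ^ 2 * ‖partialY θ t y‖ ^ 2))
      ≤ ∫ y in (-1 : ℝ)..1, hypocoerciveDensity ε s (θ t y).re (θ t y).im
        (partialY θ t y).re (partialY θ t y).im := by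
    rw [← intervalIntegral.integral_const_mul]
    refine intervalIntegral.integral_mono_on (by norm_num)
      (((hsumc t).const_mul _).intervalIntegrable _ _) ((hdens t).intervalIntegrable _ _)
      fun y _ => ?_
    simp only [hnorm]
    exact le_hypocoerciveDensity hs
  have hupp : (∫ y in (-1 : ℝ)..1, hypocoerciveDensity ε s (θ 0 y).re (θ 0 y).im
        (partialY θ 0 y).re (partialY θ 0 y).im)
      ≤ 3 / 2 * (∫ y in (-1 : ℝ)..1, (‖θ 0 y‖ ^ 2 + ε ^ 2 * ‖partialY θ 0 y‖ ^ 2)) := by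
    rw [← intervalIntegral.integral_const_mul]
    refine intervalIntegral.integral_mono_on (by norm_num) ((hdens 0).intervalIntegrable _ _)
      (((hsumc 0).const_mul _).intervalIntegrable _ _) fun y _ => ?_
    simp only [hnorm]
    exact hypocoerciveDensity_le hs
  linarith [mul_le_mul_of_nonneg_right hupp (Real.exp_pos (-(1 / 48 * lam * t))).le]
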